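/- Assume f is proper and s-regular, let 1 ≤ i ≤ s, and assume i < m or d_m ≥ 2. Then: (1) there exist R > 0 and ε > 0 such that every z ∈ K_{i−1} with |z| ≥ R and dist(z/|z|, Σ_i) ≤ ε belongs to U_i; (2) U_i is relatively open in K_{i−1} and K_i is relatively closed in K_{i−1} (hence closed in ℂ^k); (3) for every sequence (z_j) in K_i with |z_j| → ∞ such that z_j/|z_j| converges to some w ∈ ℂ^k, one has P^+_{(1)}(w) = ⋯ = P^+_{(i)}(w) = 0. -/

import Mathlib

open MvPolynomial Filter Topology Metric Set

noncomputable section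

def logPlus (x : ℝ) : ℝ := max (Real.log x) 0

/-- The top-degree homogeneous part of the `j`-th coordinate polynomial of `P`. -/
def pPlus (k : ℕ) (P : Fin k → MvPolynomial (Fin k) ℂ) (j : Fin k) :
    MvPolynomial (Fin k) ℂ :=
  homogeneousComponent (P j).totalDegree (P j)

/-- `Σ_i`: unit-sphere slice of the affine cone over the attracting set `X_i` at
infinity: `‖w‖ = 1`, `P⁺_{(1)}(w) = ⋯ = P⁺_{(i−1)}(w) = 0` and `w_{(>i)} = 0`. -/
def sigmaSet (k : ℕ) (P : Fin k → MvPolynomial (Fin k) ℂ) (l : ℕ → ℕ) (i : ℕ) :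
    Set (EuclideanSpace ℂ (Fin k)) :=
  {w | ‖w‖ = 1 ∧ (∀ j : Fin k, (j : ℕ) < l (i - 1) → eval (fun t => w t) (pPlus k P j) = 0) ∧
    ∀ j : Fin k, l i ≤ (j : ℕ) → w j = 0}

/-- `U_i`: basin of the attracting set `X_i` at infinity. -/
def basin (k : ℕ) (f : EuclideanSpace ℂ (Fin k) → EuclideanSpace ℂ (Fin k))
    (P : Fin k → MvPolynomial (Fin k) ℂ) (l : ℕ → ℕ) (i : ℕ) :
    Set (EuclideanSpace ℂ (Fin k)) :=
  {z | Tendsto (fun n => ‖f^[n] z‖) atTop atTop ∧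
    Tendsto (fun n => infDist (‖f^[n] z‖⁻¹ • f^[n] z) (sigmaSet k P l i)) atTop (𝓝 0)}

/-- `K_i = K_{i−1} \ U_i` (with `K_0 = ℂ^k`), unfolded as the complement of
`U_1 ∪ ⋯ ∪ U_i`. -/
def kSet (k : ℕ) (f : EuclideanSpace ℂ (Fin k) → EuclideanSpace ℂ (Fin k))
    (P : Fin k → MvPolynomial (Fin k) ℂ) (l : ℕ → ℕ) (i : ℕ) :
    Set (EuclideanSpace ℂ (Fin k)) :=
  {z | ∀ j : ℕ, 1 ≤ j → j ≤ i → z ∉ basin k f P l j}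

/-- Euclidean norm of the sub-vector of the coordinates `a ≤ j < b`. -/
def blockNorm (k : ℕ) (z : EuclideanSpace ℂ (Fin k)) (a b : ℕ) : ℝ :=
  Real.sqrt (∑ j : Fin k, if a ≤ (j : ℕ) ∧ (j : ℕ) < b then ‖z j‖ ^ 2 else 0)

end

/-- The ideal of polynomials vanishing at the origin has height at least the number of variables. -/
theorem natCast_le_height_vanishingIdeal_zero (N : ℕ) :
    (N : ℕ∞) ≤ (MvPolynomial.vanishingIdeal ℂ {(0 : Fin N → ℂ)}).height := by
  let g : ℕ → Fin N → MvPolynomial (Fin N) ℂ := fun n j => if (j : ℕ) < n then 0 else X j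
  let p : ℕ → Ideal (MvPolynomial (Fin N) ℂ) := fun n => RingHom.ker (aeval (R := ℂ) (g n))
  have hp : ∀ n, (p n).IsPrime := fun n => RingHom.ker_isPrime _
  have hlt : ∀ n < N, p n < p (n + 1) := by
    intro n hn
    have hcomp : (aeval (R := ℂ) (g (n + 1))).comp (aeval (R := ℂ) (g n)) =
        aeval (R := ℂ) (g (n + 1)) := by
      ext1 j
      by_cases h : (j : ℕ) < n
      · have h' : (j : ℕ) < n + 1 := by omega
        simp only [AlgHom.comp_apply, aeval_X, g, h, h', if_true, map_zero]
      · simp [g, h]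
    refine lt_of_le_of_ne (fun q hq => ?_) fun h => ?_
    · have hq' : aeval (R := ℂ) (g n) q = 0 := hq
      change aeval (R := ℂ) (g (n + 1)) q = 0
      rw [← hcomp, AlgHom.comp_apply, hq', map_zero]
    · have h1 : (X ⟨n, hn⟩ : MvPolynomial (Fin N) ℂ) ∈ p (n + 1) := by
        change aeval (R := ℂ) (g (n + 1)) _ = 0
        simp [g]
      rw [← h] at h1
      have h2 : aeval (R := ℂ) (g n) (X ⟨n, hn⟩ : MvPolynomial (Fin N) ℂ) = 0 := h1
      simp [g] at h2
  have hht : ∀ n ≤ N, (n : ℕ∞) ≤ (p n).height := by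
    intro n
    induction n with
    | zero => simp
    | succ n ih =>
      intro hn
      have := hp n
      have := hp (n + 1)
      calc ((n + 1 : ℕ) : ℕ∞) = n + 1 := by simp
        _ ≤ (p n).height + 1 := by gcongr; exact ih (by omega)
        _ ≤ (p (n + 1)).height := Ideal.height_add_one_le_of_lt_of_isPrime (hlt n (by omega))
  have hN : p N ≤ MvPolynomial.vanishingIdeal ℂ {(0 : Fin N → ℂ)} := by
    intro q hq
    have hq' : aeval (R := ℂ) (g N) q = 0 := hq
    rw [mem_vanishingIdeal_singleton_iff]
    have hcomp : (aeval (R := ℂ) (0 : Fin N → ℂ)).comp (aeval (R := ℂ) (g N)) =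
        aeval (R := ℂ) (0 : Fin N → ℂ) := by
      ext1 j
      simp [g]
    rw [← hcomp, AlgHom.comp_apply, hq', map_zero]
  exact (hht N le_rfl).trans (Ideal.height_mono hN)

/-- Fewer than `N` polynomials in `N` variables which vanish at the origin have another common
zero. -/
theorem exists_ne_zero_forall_eval_eq_zero {N : ℕ} (S : Finset (MvPolynomial (Fin N) ℂ))
    (hS : S.card < N) (h0 : ∀ p ∈ S, eval 0 p = 0) :
    ∃ x : Fin N → ℂ, x ≠ 0 ∧ ∀ p ∈ S, eval x p = 0 := by
  by_contra! hne
  have hz : zeroLocus ℂ (Ideal.span (S : Set (MvPolynomial (Fin N) ℂ))) = {0} := by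
    rw [zeroLocus_span]
    ext x
    simp only [Set.mem_ofPred_eq, Set.mem_singleton_iff, Finset.mem_coe, aeval_eq_eval]
    constructor
    · intro hx
      by_contra hx0
      obtain ⟨p, hp, hpx⟩ := hne x hx0
      exact hpx (hx p hp)
    · rintro rfl
      exact h0
  have hrad := vanishingIdeal_zeroLocus_eq_radical (K := ℂ)
    (Ideal.span (S : Set (MvPolynomial (Fin N) ℂ)))
  rw [hz] at hrad
  have hmin : MvPolynomial.vanishingIdeal ℂ {(0 : Fin N → ℂ)} ∈
      (Ideal.span (S : Set (MvPolynomial (Fin N) ℂ))).minimalPrimes := by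
    rw [← Ideal.radical_minimalPrimes, ← hrad, Ideal.minimalPrimes_eq_subsingleton_self]
    exact Set.mem_singleton _
  have h1 := Ideal.height_le_card_of_mem_minimalPrimes_span_finset hmin
  have h2 := (natCast_le_height_vanishingIdeal_zero N).trans h1
  exact absurd (Nat.cast_le.1 h2) (by omega)

theorem MvPolynomial.IsHomogeneous.eval_mul_apply {σ R : Type*} [Fintype σ] [CommSemiring R]
    {p : MvPolynomial σ R} {n : ℕ} (hp : p.IsHomogeneous n) (c : R) (x : σ → R) :
    eval (fun t => c * x t) p = c ^ n * eval x p := by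
  rw [eval_eq', eval_eq', Finset.mul_sum]
  refine Finset.sum_congr rfl fun e he => ?_
  have hdeg : ∑ t, e t = n := by
    have := hp (mem_support_iff.1 he)
    rw [Finsupp.weight_apply, Finsupp.sum_fintype _ _ (by simp)] at this
    simpa using this
  simp only [mul_pow, Finset.prod_mul_distrib, Finset.prod_pow_eq_pow_sum, hdeg]
  ring

theorem EuclideanSpace.continuous_eval {k : ℕ} (p : MvPolynomial (Fin k) ℂ) :
    Continuous fun z : EuclideanSpace ℂ (Fin k) => eval (fun t => z t) p :=
  (MvPolynomial.continuous_eval p).comp (by fun_prop)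

/-- Along a divergent sequence whose normalization converges, a polynomial divided by the `D`-th
power of the norm tends to the value of its component of degree `D`. -/
theorem tendsto_eval_div_norm_pow {k D : ℕ} {p : MvPolynomial (Fin k) ℂ}
    (hD : p.totalDegree ≤ D) {zs : ℕ → EuclideanSpace ℂ (Fin k)} {w : EuclideanSpace ℂ (Fin k)}
    (hz : Tendsto (fun n => ‖zs n‖) atTop atTop)
    (hw : Tendsto (fun n => ‖zs n‖⁻¹ • zs n) atTop (𝓝 w)) :
    Tendsto (fun n => eval (fun t => zs n t) p / (‖zs n‖ : ℂ) ^ D) atTop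
      (𝓝 (eval (fun t => w t) (homogeneousComponent D p))) := by
  have hsum : p = ∑ e ∈ Finset.range (D + 1), homogeneousComponent e p := by
    conv_lhs => rw [← sum_homogeneousComponent p]
    refine Finset.sum_subset (Finset.range_mono (by omega)) fun e _ he => ?_
    exact homogeneousComponent_eq_zero _ _ (by simpa using he)
  have hinv : Tendsto (fun n => ((‖zs n‖⁻¹ : ℝ) : ℂ)) atTop (𝓝 0) := by
    exact_mod_cast (Complex.continuous_ofReal.tendsto 0).comp (tendsto_inv_atTop_zero.comp hz)
  have hterm : Tendsto (fun n => ∑ e ∈ Finset.range (D + 1), ((‖zs n‖⁻¹ : ℝ) : ℂ) ^ (D - e) *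
      eval (fun t => (‖zs n‖⁻¹ • zs n) t) (homogeneousComponent e p)) atTop
      (𝓝 (∑ e ∈ Finset.range (D + 1), (0 : ℂ) ^ (D - e) *
        eval (fun t => w t) (homogeneousComponent e p))) :=
    tendsto_finsetSum _ fun e _ => (hinv.pow _).mul
      (((EuclideanSpace.continuous_eval _).tendsto w).comp hw)
  have hlim : ∑ e ∈ Finset.range (D + 1), (0 : ℂ) ^ (D - e) *
      eval (fun t => w t) (homogeneousComponent e p) =
      eval (fun t => w t) (homogeneousComponent D p) := by
    rw [Finset.sum_range_succ, Finset.sum_eq_zero]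
    · simp
    · intro e he
      have : D - e ≠ 0 := by have := Finset.mem_range.1 he; omega
      simp [this]
  rw [hlim] at hterm
  refine hterm.congr' ?_
  filter_upwards [hz.eventually_gt_atTop 0] with n hn
  have hne : (‖zs n‖ : ℂ) ≠ 0 := by exact_mod_cast hn.ne'
  conv_rhs => rw [hsum]
  rw [map_sum, Finset.sum_div]
  refine Finset.sum_congr rfl fun e he => ?_
  have heD : e ≤ D := by have := Finset.mem_range.1 he; omega
  have hs : (fun t => (‖zs n‖⁻¹ • zs n) t) = fun t => (((‖zs n‖⁻¹ : ℝ) : ℂ)) * zs n t := by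
    funext t
    simp
  rw [hs, (homogeneousComponent_isHomogeneous e p).eval_mul_apply, ← mul_assoc, ← pow_add,
    Nat.sub_add_cancel heD]
  rw [Complex.ofReal_inv, inv_pow, mul_comm, div_eq_mul_inv]

theorem exists_subseq_tendsto_normalize {k : ℕ} (zs : ℕ → EuclideanSpace ℂ (Fin k)) :
    ∃ (w : EuclideanSpace ℂ (Fin k)) (φ : ℕ → ℕ), StrictMono φ ∧
      Tendsto (fun n => ‖zs (φ n)‖⁻¹ • zs (φ n)) atTop (𝓝 w) := by
  obtain ⟨w, -, φ, hφ, hw⟩ := (isCompact_closedBall (0 : EuclideanSpace ℂ (Fin k)) 1).tendsto_subseq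
    (x := fun n => ‖zs n‖⁻¹ • zs n) fun n => by
      rw [mem_closedBall_zero_iff, norm_smul, norm_inv, norm_norm]
      exact inv_mul_le_one
  exact ⟨w, φ, hφ, hw⟩

/-- A limit at infinity inside `A` may be tested on sequences whose normalizations converge. -/
theorem tendsto_comap_norm_inf_principal {k : ℕ} {X : Type*} {A : Set (EuclideanSpace ℂ (Fin k))}
    {g : EuclideanSpace ℂ (Fin k) → X} {F : Filter X}
    (h : ∀ (zs : ℕ → EuclideanSpace ℂ (Fin k)) (w : EuclideanSpace ℂ (Fin k)),
      (∀ n, zs n ∈ A) → Tendsto (fun n => ‖zs n‖) atTop atTop →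
      Tendsto (fun n => ‖zs n‖⁻¹ • zs n) atTop (𝓝 w) → Tendsto (fun n => g (zs n)) atTop F) :
    Tendsto g (comap (fun z => ‖z‖) atTop ⊓ 𝓟 A) F := by
  refine tendsto_of_subseq_tendsto fun ns hns => ?_
  obtain ⟨hn1, hn2⟩ := tendsto_inf.1 hns
  obtain ⟨N, hN⟩ := eventually_atTop.1 (tendsto_principal.1 hn2)
  rw [tendsto_comap_iff] at hn1
  have hshift : Tendsto (fun n => n + N) atTop atTop := tendsto_add_atTop_nat N
  obtain ⟨w, φ, hφ, hw⟩ := exists_subseq_tendsto_normalize fun n => ns (n + N)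
  exact ⟨fun n => φ n + N, h (fun n => ns (φ n + N)) w (fun n => hN _ (by omega))
    (hn1.comp (hshift.comp hφ.tendsto_atTop)) hw⟩

theorem norm_eq_one_of_tendsto_normalize {k : ℕ} {zs : ℕ → EuclideanSpace ℂ (Fin k)}
    {w : EuclideanSpace ℂ (Fin k)} (hz : Tendsto (fun n => ‖zs n‖) atTop atTop)
    (hw : Tendsto (fun n => ‖zs n‖⁻¹ • zs n) atTop (𝓝 w)) : ‖w‖ = 1 := by
  refine tendsto_nhds_unique hw.norm (tendsto_const_nhds.congr' ?_)
  filter_upwards [hz.eventually_gt_atTop 0] with n hn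
  rw [norm_smul, norm_inv, norm_norm, inv_mul_cancel₀ hn.ne']

section Basin

variable {k : ℕ} {f : EuclideanSpace ℂ (Fin k) → EuclideanSpace ℂ (Fin k)}
  {P : Fin k → MvPolynomial (Fin k) ℂ} {l : ℕ → ℕ} {i : ℕ} {z : EuclideanSpace ℂ (Fin k)}

theorem apply_mem_basin_iff : f z ∈ basin k f P l i ↔ z ∈ basin k f P l i := by
  simp only [basin, Set.mem_ofPred_eq, ← Function.iterate_succ_apply]
  exact and_congr (tendsto_add_atTop_iff_nat (f := fun n => ‖f^[n] z‖) 1)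
    (tendsto_add_atTop_iff_nat
      (f := fun n => infDist (‖f^[n] z‖⁻¹ • f^[n] z) (sigmaSet k P l i)) 1)

theorem iterate_mem_basin_iff (n : ℕ) : f^[n] z ∈ basin k f P l i ↔ z ∈ basin k f P l i := by
  induction n with
  | zero => rfl
  | succ n ih => rw [Function.iterate_succ_apply', apply_mem_basin_iff, ih]

theorem apply_mem_kSet (hz : z ∈ kSet k f P l i) : f z ∈ kSet k f P l i :=
  fun j h1 h2 h => hz j h1 h2 (apply_mem_basin_iff.1 h)

theorem iterate_mem_kSet (hz : z ∈ kSet k f P l i) (n : ℕ) : f^[n] z ∈ kSet k f P l i :=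
  fun j h1 h2 h => hz j h1 h2 ((iterate_mem_basin_iff n).1 h)

theorem kSet_zero : kSet k f P l 0 = Set.univ :=
  Set.eq_univ_of_forall fun _ _ h1 h2 => absurd h1 (by omega)

theorem kSet_eq_diff (hi : 1 ≤ i) :
    kSet k f P l i = kSet k f P l (i - 1) \ basin k f P l i := by
  ext z
  refine ⟨fun h => ⟨fun j h1 h2 => h j h1 (by omega), h i hi le_rfl⟩, fun h j h1 h2 => ?_⟩
  rcases h2.lt_or_eq with h2 | rfl
  · exact h.1 j h1 (by omega)
  · exact h.2

end Basin

theorem isClosed_sigmaSet (k : ℕ) (P : Fin k → MvPolynomial (Fin k) ℂ) (l : ℕ → ℕ) (i : ℕ) :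
    IsClosed (sigmaSet k P l i) := by
  simp only [sigmaSet, Set.ofPred_and, Set.ofPred_forall]
  refine (isClosed_eq continuous_norm continuous_const).inter (IsClosed.inter ?_ ?_)
  · exact isClosed_iInter fun j => isClosed_iInter fun _ =>
      isClosed_eq (EuclideanSpace.continuous_eval _) continuous_const
  · exact isClosed_iInter fun j => isClosed_iInter fun _ =>
      isClosed_eq (by fun_prop) continuous_const

/-- The cone over a slice cut out by forms of positive degree is nontrivial as soon as the forms
are fewer than the free coordinates. -/
theorem sigmaSet_nonempty {k : ℕ} {P : Fin k → MvPolynomial (Fin k) ℂ} {l : ℕ → ℕ} {i : ℕ}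
    (hl : l (i - 1) < l i) (hlk : l i ≤ k)
    (hP : ∀ j : Fin k, (j : ℕ) < l (i - 1) → 1 ≤ (P j).totalDegree) :
    (sigmaSet k P l i).Nonempty := by
  classical
  let T : Finset (Fin k) := Finset.univ.filter fun j => (j : ℕ) < l (i - 1) ∨ l i ≤ (j : ℕ)
  let g : Fin k → MvPolynomial (Fin k) ℂ := fun j => if (j : ℕ) < l (i - 1) then pPlus k P j else X j
  have hT : T.card < k := by
    have : T ⊂ Finset.univ := by
      refine Finset.ssubset_univ_iff.2 fun h => ?_
      have := h ▸ Finset.mem_univ (⟨l (i - 1), by omega⟩ : Fin k)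
      simp only [T, Finset.mem_filter] at this
      omega
    simpa using Finset.card_lt_card this
  obtain ⟨x, hx0, hx⟩ := exists_ne_zero_forall_eval_eq_zero (T.image g)
    (Finset.card_image_le.trans_lt hT) (by
      intro p hp
      obtain ⟨j, hj, rfl⟩ := Finset.mem_image.1 hp
      by_cases h : (j : ℕ) < l (i - 1)
      · have hhom : (pPlus k P j).IsHomogeneous _ := homogeneousComponent_isHomogeneous _ _
        have := hhom.eval_mul_apply 0 0
        simp only [Pi.zero_apply, mul_zero] at this
        simp only [g, h, if_true]
        have h1 := hP j h
        rw [zero_pow (by omega), zero_mul] at this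
        exact this
      · simp [g, h])
  let y : EuclideanSpace ℂ (Fin k) := WithLp.toLp 2 x
  have hy : y ≠ 0 := fun h => hx0 (by simpa [y] using h)
  have hc : ∀ t, (‖y‖⁻¹ • y) t = ((‖y‖⁻¹ : ℝ) : ℂ) * x t := fun t => by simp [y]
  refine ⟨‖y‖⁻¹ • y, ?_, fun j hj => ?_, fun j hj => ?_⟩
  · rw [norm_smul, norm_inv, norm_norm, inv_mul_cancel₀ (norm_ne_zero_iff.2 hy)]
  · simp only [hc]
    have hhom : (pPlus k P j).IsHomogeneous _ := homogeneousComponent_isHomogeneous _ _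
    rw [hhom.eval_mul_apply]
    have := hx (g j) (Finset.mem_image_of_mem g (by simp [T, hj]))
    simp only [g, hj, if_true] at this
    rw [this, mul_zero]
  · have := hx (g j) (Finset.mem_image_of_mem g (by simp [T, hj]))
    have h : ¬ (j : ℕ) < l (i - 1) := by omega
    simp only [g, h, if_false, eval_X] at this
    rw [hc, this, mul_zero]

section Dynamics

variable {k : ℕ} {f : EuclideanSpace ℂ (Fin k) → EuclideanSpace ℂ (Fin k)}
  {P : Fin k → MvPolynomial (Fin k) ℂ} {l : ℕ → ℕ} {i D : ℕ}

/-- Divergent sequences of `K_{i-1}` whose direction is not killed by the leading parts of the first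
`i` blocks are mapped far away, in directions close to `Σ_i`. -/
theorem growth_and_tendsto_infDist_sigmaSet
    (hf : ∀ (z : EuclideanSpace ℂ (Fin k)) (j : Fin k), f z j = eval (fun t => z t) (P j))
    (hcone : ∀ (zs : ℕ → EuclideanSpace ℂ (Fin k)) (w : EuclideanSpace ℂ (Fin k)),
      (∀ n, zs n ∈ kSet k f P l (i - 1)) → Tendsto (fun n => ‖zs n‖) atTop atTop →
      Tendsto (fun n => ‖zs n‖⁻¹ • zs n) atTop (𝓝 w) →
      ∀ j : Fin k, (j : ℕ) < l (i - 1) → eval (fun t => w t) (pPlus k P j) = 0)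
    (hD : 1 ≤ D)
    (hDeq : ∀ j : Fin k, l (i - 1) ≤ (j : ℕ) → (j : ℕ) < l i → (P j).totalDegree = D)
    (hDlt : ∀ j : Fin k, l i ≤ (j : ℕ) → (P j).totalDegree < D)
    {zs : ℕ → EuclideanSpace ℂ (Fin k)} {w : EuclideanSpace ℂ (Fin k)}
    (hzs : ∀ n, zs n ∈ kSet k f P l (i - 1)) (hz : Tendsto (fun n => ‖zs n‖) atTop atTop)
    (hw : Tendsto (fun n => ‖zs n‖⁻¹ • zs n) atTop (𝓝 w))
    (hne : ∃ j : Fin k, (j : ℕ) < l i ∧ eval (fun t => w t) (pPlus k P j) ≠ 0) :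
    (∃ c > 0, ∀ᶠ n in atTop, c * ‖zs n‖ ^ D ≤ ‖f (zs n)‖) ∧
    Tendsto (fun n => infDist (‖f (zs n)‖⁻¹ • f (zs n)) (sigmaSet k P l i)) atTop (𝓝 0) := by
  obtain ⟨j₀, hj₀, hv⟩ := hne
  have hj₀' : l (i - 1) ≤ (j₀ : ℕ) := by
    by_contra! h
    exact hv (hcone zs w hzs hz hw j₀ h)
  have hdeg := hDeq j₀ hj₀' hj₀
  rw [pPlus, hdeg] at hv
  have hlim := (tendsto_eval_div_norm_pow hdeg.le hz hw).norm
  have hgrow : ∃ c > 0, ∀ᶠ n in atTop, c * ‖zs n‖ ^ D ≤ ‖f (zs n)‖ := by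
    refine ⟨_, half_pos (norm_pos_iff.2 hv), ?_⟩
    filter_upwards [hlim.eventually_const_lt (half_lt_self (norm_pos_iff.2 hv)),
      hz.eventually_gt_atTop 0] with n hn hn0
    rw [norm_div, norm_pow, Complex.norm_real, norm_norm, lt_div_iff₀ (by positivity), ← hf] at hn
    exact hn.le.trans (PiLp.norm_apply_le _ _)
  refine ⟨hgrow, ?_⟩
  obtain ⟨c, hc, hgrow⟩ := hgrow
  have hF : Tendsto (fun n => ‖f (zs n)‖) atTop atTop :=
    tendsto_atTop_mono' _ hgrow
      (((tendsto_pow_atTop (by omega : D ≠ 0)).comp hz).const_mul_atTop hc)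
  have hzero : ∀ j : Fin k, l i ≤ (j : ℕ) →
      Tendsto (fun n => (‖f (zs n)‖⁻¹ • f (zs n)) j) atTop (𝓝 0) := by
    intro j hj
    have h := (tendsto_eval_div_norm_pow (hDlt j hj).le hz hw).norm
    rw [homogeneousComponent_eq_zero _ _ (hDlt j hj), map_zero, norm_zero] at h
    have h' := h.const_mul c⁻¹
    rw [mul_zero] at h'
    refine squeeze_zero_norm' ?_ h'
    filter_upwards [hgrow, hz.eventually_gt_atTop 0] with n hn hn0
    rw [norm_div, norm_pow, Complex.norm_real, norm_norm, PiLp.smul_apply, norm_smul, norm_inv,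
      norm_norm, hf, div_eq_inv_mul, ← mul_assoc, ← mul_inv]
    gcongr
  refine tendsto_of_subseq_tendsto fun ns hns => ?_
  obtain ⟨w', φ, hφ, hw'⟩ := exists_subseq_tendsto_normalize fun n => f (zs (ns n))
  have hsub : Tendsto (fun n => ns (φ n)) atTop atTop := hns.comp hφ.tendsto_atTop
  have hmem : w' ∈ sigmaSet k P l i := by
    refine ⟨norm_eq_one_of_tendsto_normalize (hF.comp hsub) hw',
      hcone (fun n => f (zs (ns (φ n)))) w' (fun n => apply_mem_kSet (hzs _)) (hF.comp hsub) hw',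
      fun j hj => ?_⟩
    have hcont : Continuous fun x : EuclideanSpace ℂ (Fin k) => x j := by fun_prop
    exact tendsto_nhds_unique ((hcont.tendsto w').comp hw') ((hzero j hj).comp hsub)
  have h := ((continuous_infDist_pt (sigmaSet k P l i)).tendsto w').comp hw'
  rw [infDist_zero_of_mem hmem] at h
  exact ⟨φ, h⟩

/-- Directions uniformly close to `Σ_i` are not killed by the leading parts of the first `i`
blocks. -/
theorem exists_infDist_le_imp_eval_ne_zero (hne : (sigmaSet k P l i).Nonempty)
    (hreg : ∀ z : Fin k → ℂ, (∀ j : Fin k, (j : ℕ) < l i → eval z (pPlus k P j) = 0) →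
      (∀ j : Fin k, l i ≤ (j : ℕ) → z j = 0) → z = 0) :
    ∃ ε > 0, ∀ w : EuclideanSpace ℂ (Fin k), ‖w‖ = 1 → infDist w (sigmaSet k P l i) ≤ ε →
      ∃ j : Fin k, (j : ℕ) < l i ∧ eval (fun t => w t) (pPlus k P j) ≠ 0 := by
  let T : Set (EuclideanSpace ℂ (Fin k)) := sphere 0 1 ∩
    ⋂ j : Fin k, ⋂ _ : (j : ℕ) < l i, {w | eval (fun t => w t) (pPlus k P j) = 0}
  have hT : IsCompact T := (isCompact_sphere _ _).inter_right <|
    isClosed_iInter fun j => isClosed_iInter fun _ =>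
      isClosed_eq (EuclideanSpace.continuous_eval _) continuous_const
  have hpos : ∀ w ∈ T, 0 < infDist w (sigmaSet k P l i) := by
    intro w hw
    refine ((isClosed_sigmaSet k P l i).notMem_iff_infDist_pos hne).1 fun hmem => ?_
    have h0 := hreg (fun t => w t) (by simpa [T] using hw.2) hmem.2.2
    have : w = 0 := by
      ext t
      exact congrFun h0 t
    have h1 := hmem.1
    simp [this] at h1
  obtain ⟨δ, hδ, hT'⟩ := hT.exists_forall_le' (continuous_infDist_pt _).continuousOn hpos
  refine ⟨δ / 2, half_pos hδ, fun w hw hd => ?_⟩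
  by_contra! h
  have := hT' w ⟨by simpa using hw, by simpa using h⟩
  linarith

/-- The conclusion for the index `i`, given the asymptotic description of `K_{i-1}`. -/
theorem basin_attracting_and_closed (hi : 1 ≤ i)
    (hf : ∀ (z : EuclideanSpace ℂ (Fin k)) (j : Fin k), f z j = eval (fun t => z t) (P j))
    (hclosed : IsClosed (kSet k f P l (i - 1)))
    (hcone : ∀ (zs : ℕ → EuclideanSpace ℂ (Fin k)) (w : EuclideanSpace ℂ (Fin k)),
      (∀ n, zs n ∈ kSet k f P l (i - 1)) → Tendsto (fun n => ‖zs n‖) atTop atTop →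
      Tendsto (fun n => ‖zs n‖⁻¹ • zs n) atTop (𝓝 w) →
      ∀ j : Fin k, (j : ℕ) < l (i - 1) → eval (fun t => w t) (pPlus k P j) = 0)
    (hD : 2 ≤ D)
    (hDeq : ∀ j : Fin k, l (i - 1) ≤ (j : ℕ) → (j : ℕ) < l i → (P j).totalDegree = D)
    (hDlt : ∀ j : Fin k, l i ≤ (j : ℕ) → (P j).totalDegree < D)
    (hne : (sigmaSet k P l i).Nonempty)
    (hreg : ∀ z : Fin k → ℂ, (∀ j : Fin k, (j : ℕ) < l i → eval z (pPlus k P j) = 0) →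
      (∀ j : Fin k, l i ≤ (j : ℕ) → z j = 0) → z = 0) :
    (∃ R ε : ℝ, 0 < R ∧ 0 < ε ∧
      ∀ z ∈ kSet k f P l (i - 1), R ≤ ‖z‖ →
        infDist (‖z‖⁻¹ • z) (sigmaSet k P l i) ≤ ε → z ∈ basin k f P l i) ∧
    (∃ V : Set (EuclideanSpace ℂ (Fin k)), IsOpen V ∧
      kSet k f P l (i - 1) ∩ basin k f P l i = kSet k f P l (i - 1) ∩ V) ∧
    (∃ C : Set (EuclideanSpace ℂ (Fin k)), IsClosed C ∧
      kSet k f P l (i - 1) ∩ kSet k f P l i = kSet k f P l (i - 1) ∩ C) ∧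
    IsClosed (kSet k f P l i) ∧
    (∀ (zs : ℕ → EuclideanSpace ℂ (Fin k)) (w : EuclideanSpace ℂ (Fin k)),
      (∀ n, zs n ∈ kSet k f P l i) →
      Tendsto (fun n => ‖zs n‖) atTop atTop →
      Tendsto (fun n => ‖zs n‖⁻¹ • zs n) atTop (𝓝 w) →
      ∀ j : Fin k, (j : ℕ) < l i → eval (fun t => w t) (pPlus k P j) = 0) := by
  set S := sigmaSet k P l i with hS
  have hfc : Continuous f := by
    refine (PiLp.continuous_toLp 2 _).comp (f := fun z j => f z j) (continuous_pi fun j => ?_)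
    simp only [hf]
    exact EuclideanSpace.continuous_eval _
  obtain ⟨ε, hε, hεw⟩ := exists_infDist_le_imp_eval_ne_zero hne hreg
  let A : Set (EuclideanSpace ℂ (Fin k)) :=
    kSet k f P l (i - 1) ∩ {z | infDist (‖z‖⁻¹ • z) S ≤ ε}
  have hlim : ∀ (zs : ℕ → EuclideanSpace ℂ (Fin k)) (w : EuclideanSpace ℂ (Fin k)),
      (∀ n, zs n ∈ A) → Tendsto (fun n => ‖zs n‖) atTop atTop →
      Tendsto (fun n => ‖zs n‖⁻¹ • zs n) atTop (𝓝 w) →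
      ∃ j : Fin k, (j : ℕ) < l i ∧ eval (fun t => w t) (pPlus k P j) ≠ 0 := fun zs w hzs hz hw =>
    hεw w (norm_eq_one_of_tendsto_normalize hz hw)
      (le_of_tendsto (((continuous_infDist_pt S).tendsto w).comp hw)
        (Eventually.of_forall fun n => (hzs n).2))
  have hdist : Tendsto (fun z => infDist (‖f z‖⁻¹ • f z) S)
      (comap (fun z => ‖z‖) atTop ⊓ 𝓟 A) (𝓝 0) :=
    tendsto_comap_norm_inf_principal fun zs w hzs hz hw =>
      (growth_and_tendsto_infDist_sigmaSet hf hcone (by omega) hDeq hDlt (fun n => (hzs n).1) hz hw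
        (hlim zs w hzs hz hw)).2
  have hratio : Tendsto (fun z => ‖f z‖ / ‖z‖) (comap (fun z => ‖z‖) atTop ⊓ 𝓟 A) atTop := by
    refine tendsto_comap_norm_inf_principal fun zs w hzs hz hw => ?_
    obtain ⟨c, hc, hgrow⟩ := (growth_and_tendsto_infDist_sigmaSet hf hcone (by omega) hDeq hDlt
      (fun n => (hzs n).1) hz hw (hlim zs w hzs hz hw)).1
    refine tendsto_atTop_mono' _ ?_
      (((tendsto_pow_atTop (by omega : D - 1 ≠ 0)).comp hz).const_mul_atTop hc)
    filter_upwards [hgrow, hz.eventually_gt_atTop 0] with n hn hn0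
    rw [le_div_iff₀ hn0, Function.comp_apply, mul_assoc, ← pow_succ, Nat.sub_add_cancel (by omega)]
    exact hn
  obtain ⟨R, hR0, hR⟩ : ∃ R : ℝ, 0 < R ∧ ∀ z ∈ A, R ≤ ‖z‖ → 2 ≤ ‖f z‖ / ‖z‖ ∧
      infDist (‖f z‖⁻¹ • f z) S ≤ ε := by
    have hev := (hratio.eventually_ge_atTop 2).and (hdist.eventually_le_const hε)
    rw [eventually_inf_principal, eventually_comap] at hev
    obtain ⟨R, hR⟩ := eventually_atTop.1 hev
    exact ⟨max R 1, by positivity, fun z hz hRz => hR ‖z‖ ((le_max_left _ _).trans hRz) z rfl hz⟩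
  have hattr : ∀ z ∈ kSet k f P l (i - 1), R ≤ ‖z‖ →
      infDist (‖z‖⁻¹ • z) S ≤ ε → z ∈ basin k f P l i := by
    intro z hzK hRz hzε
    have hit : ∀ n, 2 ^ n * R ≤ ‖f^[n] z‖ ∧ f^[n] z ∈ A := by
      intro n
      induction n with
      | zero => exact ⟨by simpa using hRz, hzK, hzε⟩
      | succ n ih =>
        have hRn : R ≤ ‖f^[n] z‖ :=
          (le_mul_of_one_le_left hR0.le (one_le_pow₀ one_le_two)).trans ih.1
        obtain ⟨h1, h2⟩ := hR _ ih.2 hRn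
        rw [le_div_iff₀ (hR0.trans_le hRn)] at h1
        rw [Function.iterate_succ_apply']
        refine ⟨?_, apply_mem_kSet ih.2.1, h2⟩
        rw [pow_succ]
        linarith [ih.1]
    have hinf : Tendsto (fun n => ‖f^[n] z‖) atTop atTop :=
      tendsto_atTop_mono (fun n => (hit n).1)
        ((tendsto_pow_atTop_atTop_of_one_lt one_lt_two).atTop_mul_const hR0)
    refine ⟨hinf, ?_⟩
    rw [← tendsto_add_atTop_iff_nat 1]
    simp only [Function.iterate_succ_apply']
    exact hdist.comp (tendsto_inf.2 ⟨tendsto_comap_iff.2 hinf,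
      tendsto_principal.2 (Eventually.of_forall fun n => (hit n).2)⟩)
  let W : Set (EuclideanSpace ℂ (Fin k)) := {z | R < ‖z‖ ∧ infDist (‖z‖⁻¹ • z) S < ε}
  have hW : IsOpen W := by
    rw [isOpen_iff_mem_nhds]
    rintro z ⟨hz1, hz2⟩
    have hz0 : ‖z‖ ≠ 0 := (hR0.trans hz1).ne'
    have hcont : ContinuousAt (fun z : EuclideanSpace ℂ (Fin k) => infDist (‖z‖⁻¹ • z) S) z :=
      (continuous_infDist_pt S).continuousAt.comp
        ((continuous_norm.continuousAt.inv₀ hz0).smul continuousAt_id)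
    exact (continuous_norm.continuousAt.eventually_const_lt hz1).and
      (hcont.eventually_lt_const hz2)
  let V : Set (EuclideanSpace ℂ (Fin k)) := ⋃ n, f^[n] ⁻¹' W
  have hV : IsOpen V := isOpen_iUnion fun n => hW.preimage (hfc.iterate n)
  have hUV : ∀ z ∈ kSet k f P l (i - 1), z ∈ basin k f P l i ↔ z ∈ V := by
    intro z hz
    constructor
    · rintro ⟨h1, h2⟩
      obtain ⟨n, hn⟩ := ((h1.eventually_gt_atTop R).and (h2.eventually_lt_const hε)).exists
      exact Set.mem_iUnion.2 ⟨n, hn⟩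
    · intro h
      obtain ⟨n, hn⟩ := Set.mem_iUnion.1 h
      exact (iterate_mem_basin_iff n).1 (hattr _ (iterate_mem_kSet hz n) hn.1.le hn.2.le)
  have hK : kSet k f P l i = kSet k f P l (i - 1) ∩ Vᶜ := by
    rw [kSet_eq_diff hi]
    ext z
    exact and_congr_right fun hz => not_congr (hUV z hz)
  refine ⟨⟨R, ε, hR0, hε, hattr⟩, ⟨V, hV, ?_⟩, ⟨Vᶜ, hV.isClosed_compl, ?_⟩, ?_, ?_⟩
  · ext z
    exact and_congr_right fun hz => hUV z hz
  · rw [hK, ← Set.inter_assoc, Set.inter_self]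
  · rw [hK]
    exact hclosed.inter hV.isClosed_compl
  · intro zs w hzs hz hw
    by_contra! hj
    have hzs' : ∀ n, zs n ∈ kSet k f P l (i - 1) := fun n => by
      have := hzs n
      rw [hK] at this
      exact this.1
    obtain ⟨⟨c, hc, hgrow⟩, hd⟩ :=
      growth_and_tendsto_infDist_sigmaSet hf hcone (by omega) hDeq hDlt hzs' hz hw hj
    have hF : Tendsto (fun n => ‖f (zs n)‖) atTop atTop :=
      tendsto_atTop_mono' _ hgrow
        (((tendsto_pow_atTop (by omega : D ≠ 0)).comp hz).const_mul_atTop hc)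
    obtain ⟨n, hn1, hn2⟩ :=
      ((hF.eventually_ge_atTop R).and (hd.eventually_le_const hε)).exists
    exact hzs n i hi le_rfl (apply_mem_basin_iff.1 (hattr _ (apply_mem_kSet (hzs' n)) hn1 hn2))

end Dynamics

section Degrees

variable {k m : ℕ} {l d : ℕ → ℕ} {P : Fin k → MvPolynomial (Fin k) ℂ}

theorem degree_le_degree (hdmono : ∀ i, 1 ≤ i → i < m → d (i + 1) < d i) {i r : ℕ} (hi : 1 ≤ i)
    (hir : i ≤ r) (hr : r ≤ m) : d r ≤ d i := by
  induction r, hir using Nat.le_induction with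
  | base => exact le_rfl
  | succ r hir ih => exact (hdmono r (hi.trans hir) (by omega)).le.trans (ih (by omega))

theorem exists_block_of_lt {i r : ℕ} (hir : i ≤ r) {j : ℕ} (h1 : l i ≤ j) (h2 : j < l r) :
    ∃ t, i ≤ t ∧ t < r ∧ l t ≤ j ∧ j < l (t + 1) := by
  induction r, hir using Nat.le_induction with
  | base => omega
  | succ r hir ih =>
    by_cases h : j < l r
    · obtain ⟨t, ht1, ht2, ht⟩ := ih h
      exact ⟨t, ht1, by omega, ht⟩
    · exact ⟨r, hir, by omega, by omega, h2⟩

theorem totalDegree_lt_of_block_le (hlm : l m = k)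
    (hdeg : ∀ i, 1 ≤ i → i ≤ m → ∀ j : Fin k,
      l (i - 1) ≤ (j : ℕ) → (j : ℕ) < l i → (P j).totalDegree = d i)
    (hdmono : ∀ i, 1 ≤ i → i < m → d (i + 1) < d i) {i : ℕ} (hi : 1 ≤ i) (him : i ≤ m)
    {j : Fin k} (hj : l i ≤ (j : ℕ)) : (P j).totalDegree < d i := by
  obtain ⟨t, ht1, ht2, ht3, ht4⟩ := exists_block_of_lt him hj (by rw [hlm]; exact j.2)
  rw [hdeg (t + 1) (by omega) (by omega) j ht3 ht4]
  exact (hdmono t (by omega) ht2).trans_le (degree_le_degree hdmono hi ht1 (by omega))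

theorem one_le_totalDegree (hl0 : l 0 = 0) (hlm : l m = k)
    (hdeg : ∀ i, 1 ≤ i → i ≤ m → ∀ j : Fin k,
      l (i - 1) ≤ (j : ℕ) → (j : ℕ) < l i → (P j).totalDegree = d i)
    (hdmono : ∀ i, 1 ≤ i → i < m → d (i + 1) < d i) (hdm : 1 ≤ d m) (j : Fin k) :
    1 ≤ (P j).totalDegree := by
  obtain ⟨t, -, ht2, ht3, ht4⟩ :=
    exists_block_of_lt (Nat.zero_le m) (hl0.trans_le (Nat.zero_le _)) (by rw [hlm]; exact j.2)
  rw [hdeg (t + 1) (by omega) (by omega) j ht3 ht4]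
  exact hdm.trans (degree_le_degree hdmono (by omega) ht2 le_rfl)

theorem two_le_degree (hdmono : ∀ i, 1 ≤ i → i < m → d (i + 1) < d i) (hdm : 1 ≤ d m) {i : ℕ}
    (hi : 1 ≤ i) (him : i ≤ m) (hcase : i < m ∨ 2 ≤ d m) : 2 ≤ d i := by
  rcases hcase with h | h
  · have h1 := degree_le_degree hdmono (by omega : 1 ≤ i + 1) h le_rfl
    have h2 := hdmono i hi h
    omega
  · exact h.trans (degree_le_degree hdmono hi him le_rfl)

theorem block_le_block (hlmono : ∀ i < m, l i < l (i + 1)) {i r : ℕ} (hir : i ≤ r) (hr : r ≤ m) :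
    l i ≤ l r := by
  induction r, hir using Nat.le_induction with
  | base => exact le_rfl
  | succ r hir ih => exact (ih (by omega)).trans (hlmono r (by omega)).le

end Degrees

/-- (Lemma 2.2, parts 2–3.) For a proper `s`-regular map and
`1 ≤ i ≤ s` (with `i < m` or `d_m ≥ 2`): points of `K_{i−1}` close to `X_i` at
infinity lie in the basin `U_i`; `U_i` is relatively open and `K_i` relatively closed
in `K_{i−1}` (hence `K_i` is closed in `ℂ^k`); and any divergent sequence of `K_i`
whose normalized sequence converges has its limit in the cone
`{P⁺_{(1)} = ⋯ = P⁺_{(i)} = 0}`. -/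
theorem stmt6 (k m s : ℕ) (hk : 0 < k)
    (l : ℕ → ℕ) (hl0 : l 0 = 0) (hlm : l m = k)
    (hlmono : ∀ i < m, l i < l (i + 1))
    (P : Fin k → MvPolynomial (Fin k) ℂ)
    (d : ℕ → ℕ)
    (hdeg : ∀ i, 1 ≤ i → i ≤ m → ∀ j : Fin k,
      l (i - 1) ≤ (j : ℕ) → (j : ℕ) < l i → (P j).totalDegree = d i)
    (hdmono : ∀ i, 1 ≤ i → i < m → d (i + 1) < d i)
    (hdm : 1 ≤ d m)
    (f : EuclideanSpace ℂ (Fin k) → EuclideanSpace ℂ (Fin k))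
    (hf : ∀ (z : EuclideanSpace ℂ (Fin k)) (j : Fin k),
      f z j = eval (fun t => z t) (P j))
    (hproper : IsProperMap f)
    (hs1 : 1 ≤ s) (hsm : s ≤ m)
    (hreg : ∀ r, 1 ≤ r → r ≤ s → ∀ z : Fin k → ℂ,
      (∀ j : Fin k, (j : ℕ) < l r → eval z (pPlus k P j) = 0) →
      (∀ j : Fin k, l r ≤ (j : ℕ) → z j = 0) → z = 0)
    (i : ℕ) (hi1 : 1 ≤ i) (his : i ≤ s)
    (hcase : i < m ∨ 2 ≤ d m) :
    (∃ R ε : ℝ, 0 < R ∧ 0 < ε ∧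
      ∀ z ∈ kSet k f P l (i - 1), R ≤ ‖z‖ →
        infDist (‖z‖⁻¹ • z) (sigmaSet k P l i) ≤ ε → z ∈ basin k f P l i) ∧
    (∃ V : Set (EuclideanSpace ℂ (Fin k)), IsOpen V ∧
      kSet k f P l (i - 1) ∩ basin k f P l i = kSet k f P l (i - 1) ∩ V) ∧
    (∃ C : Set (EuclideanSpace ℂ (Fin k)), IsClosed C ∧
      kSet k f P l (i - 1) ∩ kSet k f P l i = kSet k f P l (i - 1) ∩ C) ∧
    IsClosed (kSet k f P l i) ∧
    (∀ (zs : ℕ → EuclideanSpace ℂ (Fin k)) (w : EuclideanSpace ℂ (Fin k)),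
      (∀ n, zs n ∈ kSet k f P l i) →
      Tendsto (fun n => ‖zs n‖) atTop atTop →
      Tendsto (fun n => ‖zs n‖⁻¹ • zs n) atTop (𝓝 w) →
      ∀ j : Fin k, (j : ℕ) < l i → eval (fun t => w t) (pPlus k P j) = 0) := by
  have hstep : ∀ r, 1 ≤ r → r ≤ s → (r < m ∨ 2 ≤ d m) → IsClosed (kSet k f P l (r - 1)) → _ → _ :=
    fun r hr1 hrs hr hclosed hcone => basin_attracting_and_closed hr1 hf hclosed hcone
      (two_le_degree hdmono hdm hr1 (hrs.trans hsm) hr) (hdeg r hr1 (hrs.trans hsm))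
      (fun j hj => totalDegree_lt_of_block_le hlm hdeg hdmono hr1 (hrs.trans hsm) hj)
      (sigmaSet_nonempty
        (by simpa [Nat.sub_add_cancel hr1] using hlmono (r - 1) (by omega))
        ((block_le_block hlmono (hrs.trans hsm) le_rfl).trans_eq hlm)
        fun j _ => one_le_totalDegree hl0 hlm hdeg hdmono hdm j)
      (hreg r hr1 hrs)
  have hprev : ∀ r, r < i → IsClosed (kSet k f P l r) ∧
      ∀ (zs : ℕ → EuclideanSpace ℂ (Fin k)) (w : EuclideanSpace ℂ (Fin k)),
        (∀ n, zs n ∈ kSet k f P l r) → Tendsto (fun n => ‖zs n‖) atTop atTop →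
        Tendsto (fun n => ‖zs n‖⁻¹ • zs n) atTop (𝓝 w) →
        ∀ j : Fin k, (j : ℕ) < l r → eval (fun t => w t) (pPlus k P j) = 0 := by
    intro r
    induction r with
    | zero =>
      refine fun _ => ⟨by rw [kSet_zero]; exact isClosed_univ, fun _ _ _ _ _ j hj => ?_⟩
      omega
    | succ r ih =>
      intro hr
      obtain ⟨h1, h2⟩ := ih (by omega)
      exact (hstep (r + 1) (by omega) (by omega) (Or.inl (by omega)) h1 h2).2.2.2
  obtain ⟨h1, h2⟩ := hprev (i - 1) (by omega)
  exact hstep i hi1 his hcase h1 h2
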